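/- Fix λ > 0 and c > 0, and let k(τ, ν) = [ λ^{3/2}·c·ν·(4c − 2τ² − ν²) − 4√λ·c·ν − τ·(4τ² + λ·(4c² − 4cτ² + τ⁴ + τ²ν²)) ] / [ √λ·c·(4(τ²+ν²) + λ·(2c − τ² − ν²)²) ]. Let (τ, ν) : J → ℝ² be a differentiable solution on an interval J of the system τ' = 1 + k(τ,ν)·ν, ν' = −k(τ,ν)·τ. Then τ has at most one zero on J: if τ(s₁) = τ(s₂) = 0 for s₁, s₂ ∈ J, then s₁ = s₂. (The key fact is that whenever τ(s) = 0 one has τ'(s) = 4λc²/(4ν(s)² + λ(2c − ν(s)²)²) > 0.) -/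

import Mathlib

open Real Set

/-- The curvature function of the planar curve generating a helicoidal vertical translator
with pitch `c` in the Heisenberg group `(Nil₃, g_λ)`, expressed in terms of the support
functions `τ = ⟨γ, T⟩` and `ν = ⟨γ, N⟩`. -/
noncomputable def helicoidalCurvature (lam c τ ν : ℝ) : ℝ :=
  ((Real.sqrt lam) ^ 3 * c * ν * (4 * c - 2 * τ ^ 2 - ν ^ 2) - 4 * Real.sqrt lam * c * ν -
      τ * (4 * τ ^ 2 + lam * (4 * c ^ 2 - 4 * c * τ ^ 2 + τ ^ 4 + τ ^ 2 * ν ^ 2))) /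
    (Real.sqrt lam * c * (4 * (τ ^ 2 + ν ^ 2) + lam * (2 * c - (τ ^ 2 + ν ^ 2)) ^ 2))

/-- The denominator appearing in `τ'` at a zero of `τ` is positive. -/
lemma helicoidal_denom_pos {lam c : ℝ} (hlam : 0 < lam) (hc : 0 < c) (x : ℝ) :
    0 < 4 * x ^ 2 + lam * (2 * c - x ^ 2) ^ 2 := by
  rcases eq_or_ne x 0 with rfl | hx
  · ring_nf
    positivity
  · positivity

/-- The value of `1 + kν` at `τ = 0`. -/
lemma one_add_helicoidalCurvature_mul {lam c : ℝ} (hlam : 0 < lam) (hc : 0 < c) (x : ℝ) :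
    1 + helicoidalCurvature lam c 0 x * x =
      4 * lam * c ^ 2 / (4 * x ^ 2 + lam * (2 * c - x ^ 2) ^ 2) := by
  have hD := (helicoidal_denom_pos hlam hc x).ne'
  have hs : Real.sqrt lam ≠ 0 := (Real.sqrt_pos.mpr hlam).ne'
  have hcube : Real.sqrt lam ^ 3 = lam * Real.sqrt lam := by
    rw [pow_succ, Real.sq_sqrt hlam.le]
  have hk : helicoidalCurvature lam c 0 x =
      (lam * x * (4 * c - x ^ 2) - 4 * x) / (4 * x ^ 2 + lam * (2 * c - x ^ 2) ^ 2) := by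
    rw [helicoidalCurvature, hcube,
      ← mul_div_mul_left (lam * x * (4 * c - x ^ 2) - 4 * x) _ (mul_ne_zero hs hc.ne')]
    congr 1 <;> ring
  rw [hk, eq_div_iff hD, add_mul, mul_right_comm, div_mul_cancel₀ _ hD]
  ring

/-- A function on `[a, b]` whose derivative is positive at each of its zeros cannot vanish at
both endpoints. -/
lemma not_lt_of_deriv_pos_at_zeros {f f' : ℝ → ℝ} {a b : ℝ}
    (hf : ∀ x ∈ Icc a b, HasDerivAt f (f' x) x)
    (hpos : ∀ x ∈ Icc a b, f x = 0 → 0 < f' x) (ha : f a = 0) (hb : f b = 0) : ¬ a < b := by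
  intro hab
  have hnonneg : ∀ ⦃x⦄, x ∈ Icc a b → 0 ≤ f x :=
    image_le_of_deriv_right_lt_deriv_boundary' (f := fun _ => (0 : ℝ)) (f' := fun _ => 0)
      continuousOn_const (fun x _ => hasDerivWithinAt_const x _ 0) ha.ge
      (fun x hx => (hf x hx).continuousAt.continuousWithinAt)
      (fun x hx => (hf x (Ico_subset_Icc_self hx)).hasDerivWithinAt)
      (fun x hx h => hpos x (Ico_subset_Icc_self hx) h.symm)
  have hbmem : b ∈ Icc a b := right_mem_Icc.mpr hab.le
  have hslope : ∀ᶠ x in nhdsWithin b (Iio b), 0 < slope f b x :=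
    ((hasDerivAt_iff_tendsto_slope.mp (hf b hbmem)).mono_left
      (nhdsWithin_mono b fun _ hx => ne_of_lt hx)).eventually_const_lt (hpos b hbmem hb)
  obtain ⟨x, hx, hxab⟩ := (hslope.and (Ioo_mem_nhdsLT hab)).exists
  rw [slope_def_field, hb, sub_zero] at hx
  exact hx.not_ge (div_nonpos_of_nonneg_of_nonpos (hnonneg (Ioo_subset_Icc_self hxab))
    (sub_nonpos.mpr hxab.2.le))

/-- Along a solution of `τ' = 1 + kν`, `ν' = −kτ` on an interval `J`, the function `τ` has
at most one zero; the key fact is that at any zero of `τ` one has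
`τ' = 4λc²/(4ν² + λ(2c − ν²)²) > 0`. -/
theorem helicoidal_tau_at_most_one_zero
    (lam c : ℝ) (hlam : 0 < lam) (hc : 0 < c)
    (J : Set ℝ) (hJ : J.OrdConnected) (τ ν : ℝ → ℝ)
    (hτ : ∀ s ∈ J, HasDerivAt τ (1 + helicoidalCurvature lam c (τ s) (ν s) * ν s) s)
    (hν : ∀ s ∈ J, HasDerivAt ν (-(helicoidalCurvature lam c (τ s) (ν s)) * τ s) s) :
    (∀ s ∈ J, τ s = 0 →
      1 + helicoidalCurvature lam c (τ s) (ν s) * ν s =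
        4 * lam * c ^ 2 / (4 * (ν s) ^ 2 + lam * (2 * c - (ν s) ^ 2) ^ 2) ∧
      0 < 1 + helicoidalCurvature lam c (τ s) (ν s) * ν s) ∧
    ∀ s₁ ∈ J, ∀ s₂ ∈ J, τ s₁ = 0 → τ s₂ = 0 → s₁ = s₂ := by
  have key : ∀ s ∈ J, τ s = 0 →
      1 + helicoidalCurvature lam c (τ s) (ν s) * ν s =
        4 * lam * c ^ 2 / (4 * (ν s) ^ 2 + lam * (2 * c - (ν s) ^ 2) ^ 2) ∧
      0 < 1 + helicoidalCurvature lam c (τ s) (ν s) * ν s := by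
    intro s _ h0
    rw [h0, one_add_helicoidalCurvature_mul hlam hc]
    exact ⟨rfl, div_pos (by positivity) (helicoidal_denom_pos hlam hc _)⟩
  have hnlt : ∀ s₁ ∈ J, ∀ s₂ ∈ J, τ s₁ = 0 → τ s₂ = 0 → ¬ s₁ < s₂ :=
    fun s₁ h₁ s₂ h₂ =>
      not_lt_of_deriv_pos_at_zeros (fun s hs => hτ s (hJ.out h₁ h₂ hs))
        (fun s hs h0 => (key s (hJ.out h₁ h₂ hs) h0).2)
  exact ⟨key, fun s₁ h₁ s₂ h₂ z₁ z₂ => le_antisymm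
    (not_lt.mp (hnlt s₂ h₂ s₁ h₁ z₂ z₁)) (not_lt.mp (hnlt s₁ h₁ s₂ h₂ z₁ z₂))⟩
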